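/- Let c be a real number with 3c < −1 and let S_I be the symmetric 3×3 real matrix with rows (1,0,c),(0,c,0),(c,0,1) (the Petrov type I normal form, with Ψ₀ = Ψ₄ = 1, Ψ₂ = c, Ψ₁ = Ψ₃ = 0, 3Ψ₂/Ψ₀ < −1). Then the stabilizer algebra stab(S_I) = {A ∈ so(G) : Aᵀ·S_I + S_I·A = 0} is the zero subspace. -/

import Mathlib

open Matrix

/-- The Gram matrix of the 3-dimensional Lorentzian inner product in a null triad. -/
noncomputable def Gmat : Matrix (Fin 3) (Fin 3) ℝ := !![0, 0, -1; 0, 1/2, 0; -1, 0, 0]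

/-- The stabilizer algebra of a symmetric matrix `S` inside `so(G)`:
matrices `A` with `Aᵀ·G + G·A = 0` and `Aᵀ·S + S·A = 0`. -/
noncomputable def stab (S : Matrix (Fin 3) (Fin 3) ℝ) :
    Submodule ℝ (Matrix (Fin 3) (Fin 3) ℝ) where
  carrier := {A | Aᵀ * Gmat + Gmat * A = 0 ∧ Aᵀ * S + S * A = 0}
  zero_mem' := by constructor <;> simp
  add_mem' := by
    rintro a b ⟨ha1, ha2⟩ ⟨hb1, hb2⟩
    constructor
    · have h : (a + b)ᵀ * Gmat + Gmat * (a + b)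
          = (aᵀ * Gmat + Gmat * a) + (bᵀ * Gmat + Gmat * b) := by
        rw [Matrix.transpose_add]; noncomm_ring
      rw [h, ha1, hb1, add_zero]
    · have h : (a + b)ᵀ * S + S * (a + b)
          = (aᵀ * S + S * a) + (bᵀ * S + S * b) := by
        rw [Matrix.transpose_add]; noncomm_ring
      rw [h, ha2, hb2, add_zero]
  smul_mem' := by
    rintro c a ⟨ha1, ha2⟩
    constructor
    · have h : (c • a)ᵀ * Gmat + Gmat * (c • a) = c • (aᵀ * Gmat + Gmat * a) := by
        rw [Matrix.transpose_smul, Matrix.smul_mul, Matrix.mul_smul, smul_add]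
      rw [h, ha1, smul_zero]
    · have h : (c • a)ᵀ * S + S * (c • a) = c • (aᵀ * S + S * a) := by
        rw [Matrix.transpose_smul, Matrix.smul_mul, Matrix.mul_smul, smul_add]
      rw [h, ha2, smul_zero]

/-- The stabilizer algebra of the Petrov type I normal form
(`Ψ₀ = Ψ₄ = 1`, `Ψ₂ = c` with `3c < -1`, `Ψ₁ = Ψ₃ = 0`) is the zero subspace
(table entry `s₀ = 0` for type I). -/
theorem stab_typeI (c : ℝ) (hc : 3 * c < -1) :
    stab !![1, 0, c; 0, c, 0; c, 0, 1] = ⊥ := by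
  rw [Submodule.eq_bot_iff]
  rintro A ⟨hG, hS⟩
  have g (i j : Fin 3) := congrFun (congrFun hG i) j
  have s (i j : Fin 3) := congrFun (congrFun hS i) j
  simp only [Matrix.add_apply, Matrix.mul_apply, Fin.sum_univ_three, Matrix.transpose_apply,
    Matrix.zero_apply, Gmat] at g s
  have g00 := g 0 0
  have g01 := g 0 1
  have g02 := g 0 2
  have g11 := g 1 1
  have g12 := g 1 2
  have g22 := g 2 2
  have s00 := s 0 0
  have s01 := s 0 1
  have s12 := s 1 2
  simp at g00 g01 g02 g11 g12 g22 s00 s01 s12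
  have a20 : A 2 0 = 0 := by linarith
  have a02 : A 0 2 = 0 := by linarith
  have a11 : A 1 1 = 0 := by linarith
  have a00 : A 0 0 = 0 := by rw [a20] at s00; linarith
  have a22 : A 2 2 = 0 := by linarith
  have a10 : A 1 0 = 2 * A 2 1 := by linarith
  have a12 : A 1 2 = 2 * A 0 1 := by linarith
  rw [a10] at s01
  rw [a12] at s12
  have hc' : 1 - 9 * c ^ 2 ≠ 0 := by nlinarith
  have a01 : A 0 1 = 0 :=
    (mul_eq_zero.mp (by linear_combination s01 - 3 * c * s12 :
      (1 - 9 * c ^ 2) * A 0 1 = 0)).resolve_left hc'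
  have a21 : A 2 1 = 0 := by rw [a01] at s12; linarith
  ext i j
  fin_cases i <;> fin_cases j <;> simp [a00, a01, a02, a10, a11, a12, a20, a21, a22]
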